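/- Let c = ν₃ := √( 5/2 + (5/18)(25/18)^{1/3}·( (27 − 7√21)^{1/3} + (27 + 7√21)^{1/3} ) ), and let q_c(u,v) = −(1/35)(5u³ + 6u²v + 8uv² + 16v³) − (c/315)(35u⁴ + 40u³v + 48u²v² + 64uv³ + 128v⁴) − (1/693)(63u⁵ + 70u⁴v + 80u³v² + 96u²v³ + 128uv⁴ + 256v⁵). Then there exist t > 0, u ∈ ℝ and v < u such that, writing P(z) := 6t + ∂_v q_c(u,z) + ∂_u q_c(u,z), one has P(v) = 0, P'(v) = 0, P''(v) = 0 and P'''(v) = 0, i.e. v is a quadruple root of the quartic polynomial P. That is, ν₃ is the parameter value at which the two trailing-edge solutions of the double trailing edge become coincident. -/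

import Mathlib

/-- The polynomial q_c(u,v) of equation (4.6). -/
noncomputable def qc (c u v : ℝ) : ℝ :=
  -(1 / 35) * (5 * u ^ 3 + 6 * u ^ 2 * v + 8 * u * v ^ 2 + 16 * v ^ 3) -
    c / 315 * (35 * u ^ 4 + 40 * u ^ 3 * v + 48 * u ^ 2 * v ^ 2 + 64 * u * v ^ 3 +
      128 * v ^ 4) -
    1 / 693 * (63 * u ^ 5 + 70 * u ^ 4 * v + 80 * u ^ 3 * v ^ 2 + 96 * u ^ 2 * v ^ 3 +
      128 * u * v ^ 4 + 256 * v ^ 5)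

/-- The trailing-edge polynomial P(z) = 6t + ∂_v q_c(u,z) + ∂_u q_c(u,z). -/
noncomputable def Ptrail (c t u : ℝ) : ℝ → ℝ := fun z =>
  6 * t + deriv (fun b => qc c u b) z + deriv (fun a => qc c a z) u

/-- The leading-edge polynomial L(z) = 2t + ∂_u q_c(u,z). -/
noncomputable def Llead (c t u : ℝ) : ℝ → ℝ := fun z =>
  2 * t + deriv (fun a => qc c a z) u

/-- The real cube root. -/
noncomputable def cbrt (x : ℝ) : ℝ :=
  if x < 0 then -((-x) ^ ((1 : ℝ) / 3)) else x ^ ((1 : ℝ) / 3)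

/-- ν₃ = √(5/2 + (5/18)(25/18)^{1/3}((27 − 7√21)^{1/3} + (27 + 7√21)^{1/3})). -/
noncomputable def nu3 : ℝ :=
  Real.sqrt (5 / 2 + 5 / 18 * (25 / 18 : ℝ) ^ ((1 : ℝ) / 3) *
    (cbrt (27 - 7 * Real.sqrt 21) + cbrt (27 + 7 * Real.sqrt 21)))

theorem cbrt_pow_three (x : ℝ) : cbrt x ^ 3 = x := by
  have rpow_third {y : ℝ} (hy : 0 ≤ y) : (y ^ ((1 : ℝ) / 3)) ^ 3 = y := by
    rw [← Real.rpow_natCast, ← Real.rpow_mul hy]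
    norm_num
  unfold cbrt
  split_ifs with h
  · rw [Odd.neg_pow (by decide), rpow_third (by linarith)]
    ring
  · exact rpow_third (not_lt.mp h)

/-- `nu3 ^ 2 - 5 / 2` is the positive root of Cardano's cubic. -/
theorem exists_nu3_eq_sqrt :
    ∃ w : ℝ, nu3 = Real.sqrt (5 / 2 + w) ∧ w ^ 3 + 625 / 324 * w = 3125 / 1944 := by
  refine ⟨_, rfl, ?_⟩
  have hk : ((25 / 18 : ℝ) ^ ((1 : ℝ) / 3)) ^ 3 = 25 / 18 := by
    rw [← Real.rpow_natCast, ← Real.rpow_mul (by norm_num)]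
    norm_num
  have hα := cbrt_pow_three (27 - 7 * Real.sqrt 21)
  have hβ := cbrt_pow_three (27 + 7 * Real.sqrt 21)
  have hs : Real.sqrt 21 ^ 2 = 21 := Real.sq_sqrt (by norm_num)
  generalize (25 / 18 : ℝ) ^ ((1 : ℝ) / 3) = k at *
  generalize cbrt (27 - 7 * Real.sqrt 21) = α at *
  generalize cbrt (27 + 7 * Real.sqrt 21) = β at *
  have hαβ : k ^ 2 * α * β = -25 / 3 := by
    have hodd : Odd 3 := by decide
    refine hodd.strictMono_pow.injective ?_
    calc (k ^ 2 * α * β) ^ 3 = (k ^ 3) ^ 2 * (α ^ 3 * β ^ 3) := by ring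
      _ = (25 / 18) ^ 2 * (27 ^ 2 - 49 * Real.sqrt 21 ^ 2) := by rw [hk, hα, hβ]; ring
      _ = (-25 / 3) ^ 3 := by rw [hs]; norm_num
  have hsum : α ^ 3 + β ^ 3 = 54 := by rw [hα, hβ]; ring
  linear_combination (125 / 5832) * (k ^ 3 * hsum + 54 * hk + 3 * k * (α + β) * hαβ)

theorem hasDerivAt_quartic (a₀ a₁ a₂ a₃ a₄ z : ℝ) :
    HasDerivAt (fun x => a₀ + a₁ * x + a₂ * x ^ 2 + a₃ * x ^ 3 + a₄ * x ^ 4)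
      (a₁ + 2 * a₂ * z + 3 * a₃ * z ^ 2 + 4 * a₄ * z ^ 3) z := by
  have h := ((((hasDerivAt_const z a₀).add ((hasDerivAt_id z).const_mul a₁)).add
    ((hasDerivAt_pow 2 z).const_mul a₂)).add ((hasDerivAt_pow 3 z).const_mul a₃)).add
    ((hasDerivAt_pow 4 z).const_mul a₄)
  refine h.congr_deriv ?_
  norm_num
  ring

theorem deriv_quartic (a₀ a₁ a₂ a₃ a₄ : ℝ) :
    deriv (fun x => a₀ + a₁ * x + a₂ * x ^ 2 + a₃ * x ^ 3 + a₄ * x ^ 4) =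
      fun x => a₁ + 2 * a₂ * x + 3 * a₃ * x ^ 2 + 4 * a₄ * x ^ 3 + 0 * x ^ 4 := by
  ext z
  rw [(hasDerivAt_quartic a₀ a₁ a₂ a₃ a₄ z).deriv]
  ring

theorem hasDerivAt_quintic (a₀ a₁ a₂ a₃ a₄ a₅ z : ℝ) :
    HasDerivAt (fun x => a₀ + a₁ * x + a₂ * x ^ 2 + a₃ * x ^ 3 + a₄ * x ^ 4 + a₅ * x ^ 5)
      (a₁ + 2 * a₂ * z + 3 * a₃ * z ^ 2 + 4 * a₄ * z ^ 3 + 5 * a₅ * z ^ 4) z := by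
  refine ((hasDerivAt_quartic a₀ a₁ a₂ a₃ a₄ z).add
    ((hasDerivAt_pow 5 z).const_mul a₅)).congr_deriv ?_
  norm_num
  ring

theorem Ptrail_eq_quartic (c t u : ℝ) :
    Ptrail c t u = fun z =>
      (6 * t - (3 / 5 * u ^ 2 + 4 / 7 * c * u ^ 3 + 5 / 9 * u ^ 4)) +
      -(4 / 5 * u + 24 / 35 * c * u ^ 2 + 40 / 63 * u ^ 3) * z +
      -(8 / 5 + 32 / 35 * c * u + 48 / 63 * u ^ 2) * z ^ 2 +
      -(64 / 35 * c + 64 / 63 * u) * z ^ 3 + -(128 / 63) * z ^ 4 := by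
  ext z
  have hv : (fun b => qc c u b) = fun b =>
      (-(1 / 7) * u ^ 3 - c / 9 * u ^ 4 - 1 / 11 * u ^ 5) +
      (-(6 / 35) * u ^ 2 - 40 * c / 315 * u ^ 3 - 70 / 693 * u ^ 4) * b +
      (-(8 / 35) * u - 48 * c / 315 * u ^ 2 - 80 / 693 * u ^ 3) * b ^ 2 +
      (-(16 / 35) - 64 * c / 315 * u - 96 / 693 * u ^ 2) * b ^ 3 +
      (-(128 * c / 315) - 128 / 693 * u) * b ^ 4 + (-(256 / 693)) * b ^ 5 := by
    ext b
    unfold qc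
    ring
  have hu : (fun a => qc c a z) = fun a =>
      (-(16 / 35) * z ^ 3 - 128 * c / 315 * z ^ 4 - 256 / 693 * z ^ 5) +
      (-(8 / 35) * z ^ 2 - 64 * c / 315 * z ^ 3 - 128 / 693 * z ^ 4) * a +
      (-(6 / 35) * z - 48 * c / 315 * z ^ 2 - 96 / 693 * z ^ 3) * a ^ 2 +
      (-(1 / 7) - 40 * c / 315 * z - 80 / 693 * z ^ 2) * a ^ 3 +
      (-(c / 9) - 70 / 693 * z) * a ^ 4 + (-(1 / 11)) * a ^ 5 := by
    ext a
    unfold qc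
    ring
  unfold Ptrail
  rw [hv, hu, (hasDerivAt_quintic _ _ _ _ _ _ z).deriv, (hasDerivAt_quintic _ _ _ _ _ _ u).deriv]
  ring

/-- The vanishing of the first three derivatives of `P` at `v = -(e + s)`, where `c = 5 * e`, `u = 8 * s - e`,
amounts to two equations in `e` and `s`. -/
theorem exists_reduced_solution {w : ℝ} (hw : w ^ 3 + 625 / 324 * w = 3125 / 1944) :
    ∃ e s : ℝ, Real.sqrt (5 / 2 + w) = 5 * e ∧ 35 / 100 ≤ e ∧ e ≤ 36 / 100 ∧
      1 / 10 ≤ s ∧ s ≤ 11 / 100 ∧ 400 * s ^ 2 = 7 * (25 * e ^ 2 - 5 / 2) ∧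
      s * (252 - 2520 * e ^ 2 + 19200 * s ^ 2) + e * (2100 * e ^ 2 - 315) = 0 := by
  have hw₁ : 67 / 100 < w := by nlinarith [sq_nonneg (w + 67 / 200)]
  have hw₂ : w < 68 / 100 := by nlinarith [sq_nonneg (w + 68 / 200)]
  have he : Real.sqrt (5 / 2 + w) ^ 2 = 5 / 2 + w := Real.sq_sqrt (by linarith)
  have hs : Real.sqrt (7 * w) ^ 2 = 7 * w := Real.sq_sqrt (by linarith)
  have he₀ := Real.sqrt_nonneg (5 / 2 + w)
  have hs₀ := Real.sqrt_nonneg (7 * w)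
  obtain ⟨e, hce⟩ : ∃ e, Real.sqrt (5 / 2 + w) = 5 * e := ⟨_ / 5, by ring⟩
  obtain ⟨s, hcs⟩ : ∃ s, Real.sqrt (7 * w) = 20 * s := ⟨_ / 20, by ring⟩
  rw [hce] at he he₀
  rw [hcs] at hs hs₀
  refine ⟨e, s, hce, by nlinarith, by nlinarith, by nlinarith, by nlinarith, by linarith, ?_⟩
  have hsq : (e * (5 - 4 * w)) ^ 2 = (56 / 5 * w * s) ^ 2 := by
    linear_combination (5 - 4 * w) ^ 2 / 25 * he - 196 / 625 * w ^ 2 * hs - 972 / 625 * hw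
  have hlin : e * (5 - 4 * w) = 56 / 5 * w * s :=
    (sq_eq_sq₀ (mul_nonneg (by linarith) (by linarith))
      (mul_nonneg (by linarith) (by linarith))).mp hsq
  linear_combination -21 * hlin + (-504 / 5 * s + 84 * e) * he + 48 * s * hs

/-- At c = ν₃ the two trailing edges of the double trailing edge become coincident: there
    are t > 0, u and v < u such that v is a quadruple root of the quartic
    P(z) = 6t + ∂_v q_c(u,z) + ∂_u q_c(u,z). -/
theorem stmt17 (c : ℝ) (hc : c = nu3) :
    ∃ t u v : ℝ, 0 < t ∧ v < u ∧
      Ptrail c t u v = 0 ∧ deriv (Ptrail c t u) v = 0 ∧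
      deriv (deriv (Ptrail c t u)) v = 0 ∧
      deriv (deriv (deriv (Ptrail c t u))) v = 0 := by
  obtain ⟨w, hν, hw⟩ := exists_nu3_eq_sqrt
  obtain ⟨e, s, hce, he₁, he₂, hs₁, hs₂, h₂, h₁⟩ := exists_reduced_solution hw
  obtain rfl : c = 5 * e := by rw [hc, hν, hce]
  have hu : 44 / 100 ≤ 8 * s - e := by linarith
  have hpos : 0 < (8 * s - e) ^ 2 * (3 / 5 + 4 / 7 * (5 * e) * (8 * s - e) +
      5 / 9 * (8 * s - e) ^ 2) - 128 / 63 * (s + e) ^ 4 := by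
    have hv : (s + e) ^ 4 ≤ (47 / 100) ^ 4 := pow_le_pow_left₀ (by linarith) (by linarith) 4
    have hu₂ : (44 / 100) ^ 2 ≤ (8 * s - e) ^ 2 := pow_le_pow_left₀ (by norm_num) hu 2
    have hu₀ : 0 ≤ 8 * s - e := by linarith
    have he₀ : 0 ≤ e := by linarith
    have hrest : 0 ≤ (8 * s - e) ^ 2 * (4 / 7 * (5 * e) * (8 * s - e) +
      5 / 9 * (8 * s - e) ^ 2) := by positivity
    nlinarith
  refine ⟨((8 * s - e) ^ 2 * (3 / 5 + 4 / 7 * (5 * e) * (8 * s - e) +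
      5 / 9 * (8 * s - e) ^ 2) - 128 / 63 * (s + e) ^ 4) / 6, 8 * s - e, -(s + e),
    by linarith, by linarith, ?_⟩
  simp only [Ptrail_eq_quartic, deriv_quartic]
  refine ⟨?_, ?_, ?_, ?_⟩
  · linear_combination 4 / 315 * (s + e) * h₁ + 16 / 175 * (s + e) ^ 2 * h₂
  · linear_combination -(4 / 315) * h₁
  · linear_combination -(32 / 175) * h₂
  · ring
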